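/- Define rational numbers q_{1,0,2k} = (−1)^k/2, q_{0,2,2k−2} = (−1)^k k / (2(2k+1)), q_{0,0,2k} = (−1)^{k+1}(n_a + 2kκ/(2k+1)) (for fixed rationals n_a, κ), and q_{i,2j,2k} = 0 for i + j > 1. Define f_{i,2j,2k} by the recursion (i+2j+2k)·f_{i,2j,2k} = Σ_{u=1}^{k} (−1)^u (n_a + 2uκ/(2u+1)) f_{i,2j,2k−2u} − Σ_{u=1}^{k+1} (−1)^u (u/(2(2u+1))) f_{i,2j−2,2k−2u+2} + Σ_{u=0}^{k} ((−1)^u/2) f_{i−1,2j,2k−2u}, with f_{0,0,0} = 1. Then the generating function F(x,y,z) = Σ f_{i,2j,2k} x^i y^{2j} z^{2k} equals exp((x/2)·J₁(z) + (y²/4)·J₂(z) + J₃(z)), where J₁(z) = arctan(z)/z, J₂(z) = (z − arctan(z))/z³, and J₃(z) = −(n_a/2)ln(1+z²) + κ(arctan(z)/z − 1). -/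

import Mathlib

open Finset in
instance Prod.instHasAntidiagonal {A B : Type*} [AddMonoid A] [AddMonoid B]
    [HasAntidiagonal A] [HasAntidiagonal B] : HasAntidiagonal (A × B) where
  antidiagonal p := (antidiagonal p.1 ×ˢ antidiagonal p.2).map
    (Equiv.prodProdProdComm A A B B).toEmbedding
  mem_antidiagonal {p q} := by
    obtain ⟨⟨a, b⟩, ⟨c, d⟩⟩ := q
    obtain ⟨s, t⟩ := p
    simp [Finset.mem_map_equiv, Prod.ext_iff]

theorem Finset.sum_antidiagonal_prod {A B M : Type*} [AddMonoid A] [AddMonoid B]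
    [HasAntidiagonal A] [HasAntidiagonal B] [AddCommMonoid M] (g : (A × B) × (A × B) → M)
    (p : A × B) :
    ∑ q ∈ antidiagonal p, g q =
      ∑ a ∈ antidiagonal p.1, ∑ b ∈ antidiagonal p.2, g ((a.1, b.1), (a.2, b.2)) := by
  rw [← Finset.sum_product']
  exact Finset.sum_map _ _ _

theorem mul_natCast_mul_pow_sub_one {R : Type*} [CommSemiring R] (t : R) (n : ℕ) :
    t * (n * t ^ (n - 1)) = n * t ^ n := by
  cases n with
  | zero => simp
  | succ n =>
    rw [Nat.add_sub_cancel, pow_succ]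
    ring

theorem abs_mul_pow_le_abs (a : ℝ) {t : ℝ} (ht : t ∈ Set.Icc (0 : ℝ) 1) (n : ℕ) :
    |a * t ^ n| ≤ |a| := by
  rw [abs_mul, abs_of_nonneg (pow_nonneg ht.1 n)]
  exact mul_le_of_le_one_right (abs_nonneg _) (pow_le_one₀ ht.1 ht.2)

theorem continuousOn_tsum_mul_pow {ι : Type*} (w : ι → ℕ) {g : ι → ℝ}
    (hg : Summable fun p => |g p|) :
    ContinuousOn (fun t : ℝ => ∑' p, g p * t ^ w p) (Set.Icc 0 1) :=
  continuousOn_tsum (fun p => by fun_prop) hg fun p _ ht => abs_mul_pow_le_abs (g p) ht _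

theorem exists_hasDerivAt_tsum_mul_pow {ι : Type*} (w : ι → ℕ) {g : ι → ℝ}
    (hg : Summable fun p => |g p|) (hwg : Summable fun p => |w p * g p|) {t : ℝ}
    (ht : t ∈ Set.Ioo (0 : ℝ) 1) :
    ∃ D, t * D = ∑' p, (w p * g p) * t ^ w p ∧
      HasDerivAt (fun t : ℝ => ∑' p, g p * t ^ w p) D t := by
  refine ⟨_, ?_, hasDerivAt_tsum_of_isPreconnected (g' := fun p t => g p * (w p * t ^ (w p - 1)))
    hwg isOpen_Ioo isPreconnected_Ioo (fun p t _ => (hasDerivAt_pow _ _).const_mul _)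
    (fun p t ht => ?_) ht ?_ ht⟩
  · rw [← tsum_mul_left]
    refine tsum_congr fun p => ?_
    rw [mul_right_comm, ← mul_natCast_mul_pow_sub_one t (w p)]
    ring
  · rw [Real.norm_eq_abs, ← mul_assoc, mul_comm (g p)]
    exact abs_mul_pow_le_abs _ (Set.Ioo_subset_Icc_self ht) _
  · exact Summable.of_abs (hg.of_nonneg_of_le (fun _ => abs_nonneg _)
      fun p => abs_mul_pow_le_abs _ (Set.Ioo_subset_Icc_self ht) _)

section WeightedConvolution

variable {A : Type*} [AddCommMonoid A] [SemilatticeSup A] [CanonicallyOrderedAdd A]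
  [LocallyFiniteOrderBot A] [Finset.HasAntidiagonal A]

open Finset

theorem sum_Iic_sum_antidiagonal_le {b h : A → ℝ} (hb : ∀ p, 0 ≤ b p) (hh : ∀ p, 0 ≤ h p)
    (hs : Summable h) (P : A) :
    ∑ p ∈ Iic P, ∑ q ∈ antidiagonal p, h q.1 * b q.2 ≤ (∑' d, h d) * ∑ p ∈ Iic P, b p := by
  classical
  rw [Finset.sum_sigma']
  calc ∑ s ∈ (Iic P).sigma fun p => antidiagonal p, h s.2.1 * b s.2.2
      ≤ ∑ q ∈ Iic P ×ˢ Iic P, h q.1 * b q.2 := by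
        rw [← Finset.sum_image (s := (Iic P).sigma fun p => antidiagonal p)
          (g := fun s => s.2) (f := fun q : A × A => h q.1 * b q.2)]
        · refine sum_le_sum_of_subset_of_nonneg ?_ fun q _ _ => mul_nonneg (hh _) (hb _)
          intro q hq
          simp only [mem_image, mem_sigma, mem_Iic, HasAntidiagonal.mem_antidiagonal, Sigma.exists] at hq
          obtain ⟨p, q', ⟨hp, rfl⟩, rfl⟩ := hq
          simp only [mem_product, mem_Iic]
          exact ⟨le_self_add.trans hp, le_add_self.trans hp⟩
        · rintro ⟨p, q⟩ hp ⟨p', q'⟩ hp' h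
          simp only [coe_sigma, Set.mem_sigma_iff, mem_coe, HasAntidiagonal.mem_antidiagonal] at hp hp' h
          subst h
          obtain rfl : p = p' := hp.2.symm.trans hp'.2
          rfl
    _ = (∑ d ∈ Iic P, h d) * ∑ p ∈ Iic P, b p := by rw [sum_product, sum_mul_sum]
    _ ≤ _ := by
        gcongr
        · exact sum_nonneg fun p _ => hb p
        · exact hs.sum_le_tsum _ fun d _ => hh d

variable [OrderBot A]

theorem summable_of_weight_mul_le_sum_antidiagonal (w : A →+ ℕ) (hw : ∀ p, w p = 0 → p = 0)
    {b h : A → ℝ} (hb : ∀ p, 0 ≤ b p) (hh : ∀ p, 0 ≤ h p) (h0 : h 0 = 0) (hs : Summable h)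
    (hrec : ∀ p, w p * b p ≤ ∑ q ∈ antidiagonal p, h q.1 * b q.2) : Summable b := by
  have key : ∀ P : A, ∑ p ∈ Iic P, b p ≤ b 0 * Real.exp (∑' d, h d) := by
    intro P
    set H := ∑' d, h d with hH
    have hd : ∀ t : ℝ, HasDerivAt (fun t : ℝ => (∑ p ∈ Iic P, b p * t ^ w p) * Real.exp (-(H * t)))
        ((∑ p ∈ Iic P, b p * (w p * t ^ (w p - 1))) * Real.exp (-(H * t)) +
          (∑ p ∈ Iic P, b p * t ^ w p) * (Real.exp (-(H * t)) * -(H * 1))) t := by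
      intro t
      refine (HasDerivAt.fun_sum fun p _ => (hasDerivAt_pow _ _).const_mul _).mul ?_
      exact (((hasDerivAt_id t).const_mul H).neg).exp
    have hanti := antitoneOn_of_deriv_nonpos (convex_Icc (0 : ℝ) 1)
      (fun t _ => (hd t).continuousAt.continuousWithinAt)
      (fun t _ => (hd t).differentiableAt.differentiableWithinAt) (by
        intro t ht
        rw [interior_Icc] at ht
        obtain ⟨ht0, ht1⟩ := ht
        rw [(hd t).deriv]
        have hle : t * ∑ p ∈ Iic P, b p * (w p * t ^ (w p - 1)) ≤
            t * (H * ∑ p ∈ Iic P, b p * t ^ w p) := by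
          have hht : ∀ d, h d * t ^ w d ≤ t * h d := by
            intro d
            by_cases hd0 : w d = 0
            · simp [hw d hd0, h0]
            · rw [mul_comm]
              exact mul_le_mul_of_nonneg_right (pow_le_of_le_one ht0.le ht1.le hd0) (hh d)
          have hsum : Summable fun d => h d * t ^ w d :=
            Summable.of_nonneg_of_le (fun d => mul_nonneg (hh d) (by positivity)) hht
              (hs.mul_left t)
          calc t * ∑ p ∈ Iic P, b p * (w p * t ^ (w p - 1))
              = ∑ p ∈ Iic P, (w p * b p) * t ^ w p := by
                rw [mul_sum]
                refine sum_congr rfl fun p _ => ?_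
                rw [mul_right_comm, ← mul_natCast_mul_pow_sub_one t (w p)]
                ring
            _ ≤ ∑ p ∈ Iic P, (∑ q ∈ antidiagonal p, h q.1 * b q.2) * t ^ w p := by
                gcongr with p
                exact hrec p
            _ = ∑ p ∈ Iic P, ∑ q ∈ antidiagonal p, (h q.1 * t ^ w q.1) * (b q.2 * t ^ w q.2) := by
                refine sum_congr rfl fun p _ => ?_
                rw [sum_mul]
                refine sum_congr rfl fun q hq => ?_
                rw [← HasAntidiagonal.mem_antidiagonal.1 hq, map_add, pow_add]
                ring
            _ ≤ (∑' d, h d * t ^ w d) * ∑ p ∈ Iic P, b p * t ^ w p :=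
                sum_Iic_sum_antidiagonal_le (b := fun p => b p * t ^ w p)
                  (h := fun p => h p * t ^ w p)
                  (fun p => mul_nonneg (hb p) (by positivity))
                  (fun p => mul_nonneg (hh p) (by positivity)) hsum P
            _ ≤ (t * H) * ∑ p ∈ Iic P, b p * t ^ w p := by
                gcongr
                · exact sum_nonneg fun p _ => mul_nonneg (hb p) (by positivity)
                · rw [hH, ← tsum_mul_left]
                  exact hsum.tsum_le_tsum hht (hs.mul_left t)
            _ = _ := by ring
        have hle' := le_of_mul_le_mul_left hle ht0
        have := Real.exp_pos (-(H * t))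
        nlinarith)
    have h1 := hanti (Set.left_mem_Icc.2 zero_le_one) (Set.right_mem_Icc.2 zero_le_one) zero_le_one
    have hz : ∑ p ∈ Iic P, b p * (0 : ℝ) ^ w p = b 0 := by
      rw [sum_eq_single (0 : A)]
      · simp
      · intro p _ hp
        rw [zero_pow fun h => hp (hw p h), mul_zero]
      · intro h
        exact absurd (mem_Iic.2 zero_le) h
    simp only [hz, one_pow, mul_one, mul_zero, neg_zero, Real.exp_zero, Real.exp_neg] at h1
    rwa [← div_eq_mul_inv, div_le_iff₀ (Real.exp_pos _)] at h1
  refine summable_of_sum_le (c := b 0 * Real.exp (∑' d, h d)) hb fun S => ?_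
  refine le_trans (sum_le_sum_of_subset_of_nonneg ?_ fun p _ _ => hb p) (key (S.sup id))
  intro p hp
  exact mem_Iic.2 (le_sup (f := id) hp)

/-- If `T` satisfies `w(p) T(p) = ∑_{d + q = p} h(d) T(q)`, where `w` is an additive weight, then the
sum of `T` is the exponential of the sum of `h(d) / w(d)`. -/
theorem tsum_eq_exp_of_weight_mul_eq_sum_antidiagonal (w : A →+ ℕ) (hw : ∀ p, w p = 0 → p = 0)
    {T h : A → ℝ} (h0 : h 0 = 0) (hs : Summable h)
    (hrec : ∀ p, w p * T p = ∑ q ∈ antidiagonal p, h q.1 * T q.2) :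
    ∑' p, T p = T 0 * Real.exp (∑' d, h d / w d) := by
  have hT : Summable fun p => |T p| := by
    refine summable_of_weight_mul_le_sum_antidiagonal w hw (fun _ => abs_nonneg _)
      (fun _ => abs_nonneg _) (by simp [h0]) hs.abs fun p => ?_
    calc (w p : ℝ) * |T p| = |w p * T p| := by simp [abs_mul]
      _ ≤ _ := by
        rw [hrec]
        refine (abs_sum_le_sum_abs _ _).trans_eq ?_
        simp [abs_mul]
  have hwT : Summable fun p => |w p * T p| := by
    refine Summable.of_nonneg_of_le (fun _ => abs_nonneg _) (fun p => ?_)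
      (summable_sum_mul_antidiagonal_of_summable_mul (f := fun p => |h p|) (g := fun p => |T p|)
        (hs.abs.mul_of_nonneg hT (fun _ => abs_nonneg _) fun _ => abs_nonneg _))
    rw [hrec]
    refine (abs_sum_le_sum_abs _ _).trans_eq ?_
    simp [abs_mul]
  have hwh : ∀ d, w d * (h d / w d) = h d := by
    intro d
    by_cases hd : w d = 0
    · simp [hw d hd, h0]
    · field_simp
  have hhw : Summable fun d => |h d / w d| := by
    refine Summable.of_nonneg_of_le (fun _ => abs_nonneg _) (fun d => ?_) hs.abs
    by_cases hd : w d = 0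
    · simp [hd]
    · rw [abs_div, Nat.abs_cast]
      exact div_le_self (abs_nonneg _) (by exact_mod_cast Nat.one_le_iff_ne_zero.2 hd)
  let F : ℝ → ℝ := fun t => ∑' p, T p * t ^ w p
  let K : ℝ → ℝ := fun t => ∑' p, h p / w p * t ^ w p
  have hconst : ∀ t ∈ Set.Ioo (0 : ℝ) 1, HasDerivAt (fun t => F t * Real.exp (-K t)) 0 t := by
    intro t ht
    obtain ⟨D, hD, hFD⟩ := exists_hasDerivAt_tsum_mul_pow w hT hwT ht
    obtain ⟨E, hE, hKE⟩ := exists_hasDerivAt_tsum_mul_pow w hhw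
      (by simpa only [hwh] using hs.abs) ht
    simp only [hwh] at hE
    have hmul : t * D = (t * E) * F t := by
      have hI := Set.Ioo_subset_Icc_self ht
      have hs1 : Summable fun p => |h p * t ^ w p| :=
        hs.abs.of_nonneg_of_le (fun _ => abs_nonneg _) fun _ => abs_mul_pow_le_abs _ hI _
      have hs2 : Summable fun p => |T p * t ^ w p| :=
        hT.of_nonneg_of_le (fun _ => abs_nonneg _) fun _ => abs_mul_pow_le_abs _ hI _
      have hs1' : Summable fun p => h p * t ^ w p := hs1.of_abs
      have hs2' : Summable fun p => T p * t ^ w p := hs2.of_abs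
      have hs12 : Summable fun q : A × A => (h q.1 * t ^ w q.1) * (T q.2 * t ^ w q.2) :=
        summable_mul_of_summable_norm (f := fun p => h p * t ^ w p) (g := fun p => T p * t ^ w p)
          hs1 hs2
      rw [hD, hE, hs1'.tsum_mul_tsum_eq_tsum_sum_antidiagonal hs2' hs12]
      refine tsum_congr fun p => ?_
      rw [hrec, sum_mul]
      refine sum_congr rfl fun q hq => ?_
      rw [← HasAntidiagonal.mem_antidiagonal.1 hq, map_add, pow_add]
      ring
    have hDE : D = E * F t := mul_left_cancel₀ ht.1.ne' (by rw [hmul]; ring)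
    convert! hFD.mul hKE.neg.exp using 1
    rw [hDE]
    ring
  have hc : ContinuousOn (fun t => F t * Real.exp (-K t)) (Set.Icc 0 1) :=
    (continuousOn_tsum_mul_pow w hT).mul (continuousOn_tsum_mul_pow w hhw).neg.rexp
  obtain ⟨c, hc1, hc2⟩ := exists_hasDerivAt_eq_slope _ _ zero_lt_one hc hconst
  have h01 : F 1 * Real.exp (-K 1) = F 0 * Real.exp (-K 0) := by
    simp only [sub_zero, div_one] at hc2
    linarith
  have hat0 : ∀ g : A → ℝ, ∑' p, g p * (0 : ℝ) ^ w p = g 0 := by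
    intro g
    rw [tsum_eq_single 0]
    · simp
    · intro p hp
      rw [zero_pow fun h => hp (hw p h), mul_zero]
  have hF0 : F 0 = T 0 := hat0 T
  have hK0 : K 0 = 0 := (hat0 _).trans (by simp)
  rw [hF0, hK0, Real.exp_neg, neg_zero, Real.exp_zero, mul_one, ← div_eq_mul_inv,
    div_eq_iff (Real.exp_pos _).ne'] at h01
  simpa [F, K] using h01

end WeightedConvolution

section Slice

/-- The function on `ℕ × ℕ × ℕ` that is `α` on `{(a, b)} × ℕ` and vanishes elsewhere. -/
def slice (a b : ℕ) (α : ℕ → ℝ) (p : ℕ × ℕ × ℕ) : ℝ :=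
  if p.1 = a ∧ p.2.1 = b then α p.2.2 else 0

theorem hasSum_slice (a b : ℕ) {α : ℕ → ℝ} {s : ℝ} (hα : HasSum α s) : HasSum (slice a b α) s := by
  have hinj : Function.Injective fun u : ℕ => (a, b, u) := fun u v h => by simpa using h
  refine (hinj.hasSum_iff fun p hp => if_neg ?_).1 (by simpa [slice, Function.comp_def] using hα)
  rintro ⟨rfl, rfl⟩
  exact hp ⟨p.2.2, rfl⟩

theorem sum_antidiagonal_ite_fst_eq (a n : ℕ) (g : ℕ → ℝ) :
    ∑ q ∈ Finset.HasAntidiagonal.antidiagonal n, (if q.1 = a then g q.2 else 0) =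
      if a ≤ n then g (n - a) else 0 := by
  rw [← Finset.sum_filter, Finset.HasAntidiagonal.filter_fst_eq_antidiagonal n a]
  split_ifs <;> simp

theorem sum_antidiagonal_slice_mul (a b : ℕ) (α : ℕ → ℝ) (T : ℕ × ℕ × ℕ → ℝ) (i j k : ℕ) :
    ∑ q ∈ Finset.HasAntidiagonal.antidiagonal (i, j, k), slice a b α q.1 * T q.2 =
      if a ≤ i then if b ≤ j then
        ∑ u ∈ Finset.range (k + 1), α u * T (i - a, j - b, k - u) else 0 else 0 := by
  simp only [Finset.sum_antidiagonal_prod, slice]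
  rw [← sum_antidiagonal_ite_fst_eq a i fun i' => if b ≤ j then
    ∑ u ∈ Finset.range (k + 1), α u * T (i', j - b, k - u) else 0]
  refine Finset.sum_congr rfl fun q _ => ?_
  by_cases hq : q.1 = a
  · rw [if_pos hq, ← sum_antidiagonal_ite_fst_eq b j fun j' =>
      ∑ u ∈ Finset.range (k + 1), α u * T (q.2, j', k - u)]
    refine Finset.sum_congr rfl fun r _ => ?_
    by_cases hr : r.1 = b
    · simp [hq, hr, Finset.Nat.sum_antidiagonal_eq_sum_range_succ fun u v => α u * T (q.2, r.2, v)]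
    · simp [hr]
  · simp [hq]

/-- The weight `i + 2 j + 2 k` of the monomial `x ^ i * y ^ (2 * j) * z ^ (2 * k)`. -/
def degreeWeight : ℕ × ℕ × ℕ →+ ℕ where
  toFun p := p.1 + 2 * p.2.1 + 2 * p.2.2
  map_zero' := rfl
  map_add' p q := by
    simp only [Prod.fst_add, Prod.snd_add]
    ring

theorem degreeWeight_apply (p : ℕ × ℕ × ℕ) : degreeWeight p = p.1 + 2 * p.2.1 + 2 * p.2.2 := rfl

theorem hasSum_slice_div_degreeWeight {a b : ℕ} {α : ℕ → ℝ} {s : ℝ}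
    (hα : HasSum (fun u : ℕ => α u / (a + 2 * b + 2 * u)) s) :
    HasSum (fun p => slice a b α p / degreeWeight p) s := by
  convert! hasSum_slice a b hα using 2 with p
  simp only [slice, degreeWeight_apply]
  split_ifs with hp
  · rw [← hp.1, ← hp.2]
    push_cast
    rfl
  · exact zero_div _

end Slice

theorem Finset.sum_Icc_one_eq_sum_range {M : Type*} [AddCommMonoid M] (g : ℕ → M) (n : ℕ) :
    ∑ u ∈ Icc 1 n, g u = ∑ u ∈ range n, g (u + 1) := by
  rw [range_eq_Ico, sum_Ico_add' g 0 n 1]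
  rfl

theorem summable_mul_pow_of_abs_le {c : ℕ → ℝ} {C r : ℝ} (hc : ∀ n, |c n| ≤ C) (hr : |r| < 1) :
    Summable fun n => c n * r ^ n := by
  refine Summable.of_norm_bounded ((summable_geometric_of_lt_one (abs_nonneg r) hr).mul_left C)
    fun n => ?_
  rw [Real.norm_eq_abs, abs_mul, abs_pow]
  gcongr
  exact hc n

section DegeneracySeries

variable {z : ℝ}

theorem hasSum_arctan_div_self (hz0 : z ≠ 0) (hz : |z| < 1) :
    HasSum (fun u : ℕ => (-1) ^ u / (2 * u + 1) * z ^ (2 * u)) (Real.arctan z / z) := by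
  convert! (Real.hasSum_arctan (x := z) hz).div_const z using 2 with u
  rw [pow_succ]
  push_cast
  field_simp

theorem hasSum_self_sub_arctan_div_pow_three (hz0 : z ≠ 0) (hz : |z| < 1) :
    HasSum (fun u : ℕ => (-1) ^ u / (2 * u + 3) * z ^ (2 * u)) ((z - Real.arctan z) / z ^ 3) := by
  have h := (((hasSum_nat_add_iff' 1).2 (hasSum_arctan_div_self hz0 hz)).neg).div_const (z ^ 2)
  convert! h using 1
  · ext u
    have : (2 * (u : ℝ) + 3) ≠ 0 := by positivity
    have : (2 * ((u : ℝ) + 1) + 1) ≠ 0 := by positivity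
    push_cast
    rw [mul_add 2 u 1, pow_add z, pow_succ (-1 : ℝ)]
    field_simp
    ring
  · simp
    field_simp

theorem hasSum_neg_log_one_add_sq (hz : |z| < 1) :
    HasSum (fun u : ℕ => (-1) ^ (u + 1) / (u + 1) * z ^ (2 * (u + 1))) (-Real.log (1 + z ^ 2)) := by
  have hz2 : |-z ^ 2| < 1 := by
    rw [abs_neg, abs_pow]
    exact pow_lt_one₀ (abs_nonneg _) hz two_ne_zero
  convert! Real.hasSum_pow_div_log_of_abs_lt_one hz2 using 1
  · ext u
    rw [neg_pow (z ^ 2), pow_mul]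
    ring
  · rw [sub_neg_eq_add]

theorem abs_sq_lt_one (hz : |z| < 1) : |z ^ 2| < 1 := by
  rw [abs_pow]
  exact pow_lt_one₀ (abs_nonneg _) hz two_ne_zero

/-- The contribution of the coefficients `q_{0,0,2u}` to the logarithmic Euler derivative of the
generating function. -/
noncomputable def zTerm (na κ z : ℝ) (u : ℕ) : ℝ :=
  (if u = 0 then 0 else (-1) ^ u * (na + 2 * u * κ / (2 * u + 1))) * (z ^ 2) ^ u

/-- The contribution of the coefficients `q_{0,2,2u}` to the logarithmic Euler derivative of the
generating function. -/
noncomputable def yTerm (y z : ℝ) (u : ℕ) : ℝ :=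
  (-((-1) ^ (u + 1) * ((u + 1) / (2 * (2 * (u + 1) + 1)))) * y ^ 2) * (z ^ 2) ^ u

/-- The contribution of the coefficients `q_{1,0,2u}` to the logarithmic Euler derivative of the
generating function. -/
noncomputable def xTerm (x z : ℝ) (u : ℕ) : ℝ := ((-1) ^ u / 2 * x) * (z ^ 2) ^ u

theorem summable_zTerm (na κ : ℝ) (hz : |z| < 1) : Summable (zTerm na κ z) := by
  refine summable_mul_pow_of_abs_le (C := |na| + |κ|) (fun u => ?_) (abs_sq_lt_one hz)
  split_ifs with hu
  · simp only [abs_zero]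
    positivity
  · rw [abs_mul, abs_pow, abs_neg, abs_one, one_pow, one_mul]
    refine (abs_add_le _ _).trans (add_le_add_right ?_ _)
    rw [mul_div_right_comm, abs_mul]
    refine mul_le_of_le_one_left (abs_nonneg _) ?_
    rw [abs_of_nonneg (by positivity), div_le_one (by positivity)]
    linarith

theorem summable_yTerm (y : ℝ) (hz : |z| < 1) : Summable (yTerm y z) := by
  refine summable_mul_pow_of_abs_le (C := y ^ 2) (fun u => ?_) (abs_sq_lt_one hz)
  rw [abs_mul, abs_neg, abs_mul, abs_pow, abs_neg, abs_one, one_pow, one_mul, abs_sq]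
  refine mul_le_of_le_one_left (sq_nonneg _) ?_
  rw [abs_of_nonneg (by positivity), div_le_one (by positivity)]
  linarith [Nat.cast_nonneg (α := ℝ) u]

theorem summable_xTerm (x : ℝ) (hz : |z| < 1) : Summable (xTerm x z) := by
  refine summable_mul_pow_of_abs_le (C := |x| / 2) (fun u => le_of_eq ?_) (abs_sq_lt_one hz)
  rw [abs_mul, abs_div, abs_pow, abs_neg, abs_one, one_pow, abs_two]
  ring

theorem hasSum_zTerm_div (na κ : ℝ) (hz0 : z ≠ 0) (hz : |z| < 1) :
    HasSum (fun u : ℕ => zTerm na κ z u / (2 * u))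
      (-(na / 2) * Real.log (1 + z ^ 2) + κ * (Real.arctan z / z - 1)) := by
  have h := ((hasSum_neg_log_one_add_sq hz).mul_left (na / 2)).add
    (((hasSum_nat_add_iff' 1).2 (hasSum_arctan_div_self hz0 hz)).mul_left κ)
  rw [← hasSum_nat_add_iff' 1]
  convert! h using 1
  · ext u
    have h1 : (u : ℝ) + 1 ≠ 0 := by positivity
    have h2 : 2 * ((u : ℝ) + 1) + 1 ≠ 0 := by positivity
    simp only [zTerm, Nat.add_eq_zero_iff, one_ne_zero, and_false, if_false]
    rw [← pow_mul]
    push_cast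
    field_simp
  · simp [zTerm]

theorem hasSum_yTerm_div (y : ℝ) (hz0 : z ≠ 0) (hz : |z| < 1) :
    HasSum (fun u : ℕ => yTerm y z u / (2 + 2 * u))
      ((y ^ 2 / 4) * ((z - Real.arctan z) / z ^ 3)) := by
  convert! (hasSum_self_sub_arctan_div_pow_three hz0 hz).mul_left (y ^ 2 / 4) using 1
  ext u
  have h1 : 2 * (u : ℝ) + 3 ≠ 0 := by positivity
  have h2 : 2 * ((u : ℝ) + 1) + 1 ≠ 0 := by positivity
  have h3 : 2 + 2 * (u : ℝ) ≠ 0 := by positivity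
  simp only [yTerm]
  rw [← pow_mul, pow_succ (-1 : ℝ)]
  field_simp
  ring

theorem hasSum_xTerm_div (x : ℝ) (hz0 : z ≠ 0) (hz : |z| < 1) :
    HasSum (fun u : ℕ => xTerm x z u / (1 + 2 * u)) ((x / 2) * (Real.arctan z / z)) := by
  convert! (hasSum_arctan_div_self hz0 hz).mul_left (x / 2) using 1
  ext u
  simp only [xTerm]
  rw [← pow_mul]
  field_simp
  ring

end DegeneracySeries

theorem pow_two_mul_eq_mul_pow_sub (z : ℝ) {u k : ℕ} (hu : u ≤ k) :
    z ^ (2 * k) = (z ^ 2) ^ u * z ^ (2 * (k - u)) := by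
  rw [← pow_mul, ← pow_add, ← mul_add, Nat.add_sub_cancel' hu]

theorem sum_zTerm_mul (na κ x y z : ℝ) (f : ℕ → ℕ → ℕ → ℝ) (i j k : ℕ) :
    ∑ u ∈ Finset.range (k + 1), zTerm na κ z u *
      (f i j (k - u) * x ^ i * y ^ (2 * j) * z ^ (2 * (k - u))) =
    (∑ u ∈ Finset.Icc 1 k, (-1 : ℝ) ^ u * (na + 2 * u * κ / (2 * u + 1)) * f i j (k - u)) *
      (x ^ i * y ^ (2 * j) * z ^ (2 * k)) := by
  rw [Finset.sum_range_succ', Finset.sum_Icc_one_eq_sum_range, Finset.sum_mul]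
  simp only [zTerm, if_true, zero_mul, add_zero]
  refine Finset.sum_congr rfl fun u hu => ?_
  rw [pow_two_mul_eq_mul_pow_sub z (u := u + 1) (Finset.mem_range.1 hu), if_neg u.succ_ne_zero]
  ring

theorem sum_yTerm_mul (x y z : ℝ) (f : ℕ → ℕ → ℕ → ℝ) (i j k : ℕ) :
    (if 1 ≤ j then ∑ u ∈ Finset.range (k + 1), yTerm y z u *
      (f i (j - 1) (k - u) * x ^ i * y ^ (2 * (j - 1)) * z ^ (2 * (k - u))) else 0) =
    -(if j = 0 then 0 else ∑ u ∈ Finset.Icc 1 (k + 1),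
      (-1 : ℝ) ^ u * (u / (2 * (2 * u + 1))) * f i (j - 1) (k + 1 - u)) *
      (x ^ i * y ^ (2 * j) * z ^ (2 * k)) := by
  cases j with
  | zero => simp
  | succ j =>
    rw [if_pos (Nat.le_add_left 1 j), if_neg j.succ_ne_zero,
      Finset.sum_Icc_one_eq_sum_range, ← Finset.sum_neg_distrib, Finset.sum_mul]
    refine Finset.sum_congr rfl fun u hu => ?_
    rw [pow_two_mul_eq_mul_pow_sub z (Finset.mem_range_succ_iff.1 hu), Nat.add_sub_cancel,
      Nat.add_sub_add_right]
    simp only [yTerm]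
    push_cast
    ring

theorem sum_xTerm_mul (x y z : ℝ) (f : ℕ → ℕ → ℕ → ℝ) (i j k : ℕ) :
    (if 1 ≤ i then ∑ u ∈ Finset.range (k + 1), xTerm x z u *
      (f (i - 1) j (k - u) * x ^ (i - 1) * y ^ (2 * j) * z ^ (2 * (k - u))) else 0) =
    (if i = 0 then 0 else ∑ u ∈ Finset.Icc 0 k, ((-1 : ℝ) ^ u / 2) * f (i - 1) j (k - u)) *
      (x ^ i * y ^ (2 * j) * z ^ (2 * k)) := by
  cases i with
  | zero => simp
  | succ i =>
    rw [if_pos (Nat.le_add_left 1 i), if_neg i.succ_ne_zero, ← Nat.range_succ_eq_Icc_zero,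
      Finset.sum_mul]
    refine Finset.sum_congr rfl fun u hu => ?_
    rw [pow_two_mul_eq_mul_pow_sub z (Finset.mem_range_succ_iff.1 hu), Nat.add_sub_cancel]
    simp only [xTerm]
    ring

/-- Main combinatorial content of Theorem 1: if `f i j k` (representing `f_{i,2j,2k}`)
satisfies `f 0 0 0 = 1` and the recursion
`(i+2j+2k)·f_{i,2j,2k} = Σ_{u=1}^{k} (−1)^u (n_a + 2uκ/(2u+1)) f_{i,2j,2k−2u}
  − Σ_{u=1}^{k+1} (−1)^u (u/(2(2u+1))) f_{i,2j−2,2k−2u+2}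
  + Σ_{u=0}^{k} ((−1)^u/2) f_{i−1,2j,2k−2u}`
(terms with a negative index being zero), then for `0 < |z| < 1` and all real `x`, `y`,
`Σ f_{i,2j,2k} x^i y^{2j} z^{2k}
  = exp((x/2)J₁(z) + (y²/4)J₂(z) + J₃(z))` where `J₁(z) = arctan(z)/z`,
`J₂(z) = (z − arctan z)/z³`, `J₃(z) = −(n_a/2)ln(1+z²) + κ(arctan(z)/z − 1)`. -/
theorem degeneracy_generating_function (na κ : ℝ) (f : ℕ → ℕ → ℕ → ℝ)
    (hf0 : f 0 0 0 = 1)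
    (hrec : ∀ i j k : ℕ, ¬(i = 0 ∧ j = 0 ∧ k = 0) →
      ((i : ℝ) + 2 * j + 2 * k) * f i j k =
        (∑ u ∈ Finset.Icc 1 k,
          (-1 : ℝ) ^ u * (na + 2 * u * κ / (2 * u + 1)) * f i j (k - u))
        - (if j = 0 then 0 else ∑ u ∈ Finset.Icc 1 (k + 1),
            (-1 : ℝ) ^ u * (u / (2 * (2 * u + 1))) * f i (j - 1) (k + 1 - u))
        + (if i = 0 then 0 else ∑ u ∈ Finset.Icc 0 k,
            ((-1 : ℝ) ^ u / 2) * f (i - 1) j (k - u)))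
    (x y z : ℝ) (hz0 : 0 < |z|) (hz : |z| < 1) :
    ∑' p : ℕ × ℕ × ℕ, f p.1 p.2.1 p.2.2 * x ^ p.1 * y ^ (2 * p.2.1) * z ^ (2 * p.2.2) =
      Real.exp ((x / 2) * (Real.arctan z / z)
        + (y ^ 2 / 4) * ((z - Real.arctan z) / z ^ 3)
        + (-(na / 2) * Real.log (1 + z ^ 2) + κ * (Real.arctan z / z - 1))) := by
  have hz0' : z ≠ 0 := abs_pos.1 hz0
  let h : ℕ × ℕ × ℕ → ℝ := fun p =>
    slice 1 0 (xTerm x z) p + slice 0 1 (yTerm y z) p + slice 0 0 (zTerm na κ z) p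
  let T : ℕ × ℕ × ℕ → ℝ := fun p =>
    f p.1 p.2.1 p.2.2 * x ^ p.1 * y ^ (2 * p.2.1) * z ^ (2 * p.2.2)
  have hsum : Summable h :=
    (((hasSum_slice 1 0 (summable_xTerm x hz).hasSum).add
      (hasSum_slice 0 1 (summable_yTerm y hz).hasSum)).add
      (hasSum_slice 0 0 (summable_zTerm na κ hz).hasSum)).summable
  have hdiv := ((hasSum_slice_div_degreeWeight (a := 1) (b := 0)
      (by simpa using hasSum_xTerm_div x hz0' hz)).add
    (hasSum_slice_div_degreeWeight (a := 0) (b := 1)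
      (by simpa using hasSum_yTerm_div y hz0' hz))).add
    (hasSum_slice_div_degreeWeight (a := 0) (b := 0)
      (by simpa only [Nat.cast_zero, mul_zero, zero_add] using hasSum_zTerm_div na κ hz0' hz))
  simp only [← add_div] at hdiv
  have hT0 : T 0 = 1 := by simp [T, hf0]
  rw [← hdiv.tsum_eq, ← one_mul (Real.exp _), ← hT0]
  refine tsum_eq_exp_of_weight_mul_eq_sum_antidiagonal degreeWeight (h := h) (T := T) ?_ ?_ hsum ?_
  · rintro ⟨i, j, k⟩ hp
    simp only [degreeWeight_apply] at hp
    ext <;> simp <;> omega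
  · simp [h, slice, zTerm]
  · rintro ⟨i, j, k⟩
    simp only [h, add_mul, Finset.sum_add_distrib, sum_antidiagonal_slice_mul, degreeWeight_apply]
    by_cases h0 : i = 0 ∧ j = 0 ∧ k = 0
    · obtain ⟨rfl, rfl, rfl⟩ := h0
      simp [zTerm]
    · simp only [T, Nat.zero_le, if_true, Nat.sub_zero]
      rw [sum_zTerm_mul, sum_yTerm_mul, sum_xTerm_mul]
      push_cast
      linear_combination (x ^ i * y ^ (2 * j) * z ^ (2 * k)) * hrec i j k h0
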